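/- Let X be a GC_5 set of 21 nodes with no maximal line, and let ℓ̃ be a 2-node line for X. Then ℓ̃ is used by at most one node of X. -/

import Mathlib

open MvPolynomial

/-- Evaluation of a bivariate polynomial at a point of the real plane. -/
noncomputable def ev (p : MvPolynomial (Fin 2) ℝ) (A : ℝ × ℝ) : ℝ :=
  MvPolynomial.eval ![A.1, A.2] p

/-- A polynomial of total degree exactly 1, defining a line. -/
def IsLinePoly (l : MvPolynomial (Fin 2) ℝ) : Prop := l.totalDegree = 1

/-- The line (zero set) defined by a polynomial. -/
def lineSet (l : MvPolynomial (Fin 2) ℝ) : Set (ℝ × ℝ) := {A | ev l A = 0}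

/-- The number of nodes of `X` lying on the line defined by `l`. -/
noncomputable def nodesOn (X : Set (ℝ × ℝ)) (l : MvPolynomial (Fin 2) ℝ) : ℕ :=
  (X ∩ lineSet l).ncard

/-- `X` is an `n`-poised set: it has `N = (n+2)(n+1)/2` nodes and the only polynomial of
degree ≤ n vanishing on all of `X` is the zero polynomial. -/
def Poised (n : ℕ) (X : Set (ℝ × ℝ)) : Prop :=
  X.Finite ∧ X.ncard = (n + 2) * (n + 1) / 2 ∧
    ∀ p : MvPolynomial (Fin 2) ℝ, p.totalDegree ≤ n → (∀ A ∈ X, ev p A = 0) → p = 0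

/-- `p` is an `n`-fundamental polynomial of the node `A` with respect to `X`. -/
def IsFund (n : ℕ) (X : Set (ℝ × ℝ)) (A : ℝ × ℝ) (p : MvPolynomial (Fin 2) ℝ) : Prop :=
  p.totalDegree ≤ n ∧ ev p A = 1 ∧ ∀ B ∈ X, B ≠ A → ev p B = 0

/-- `X` is a `GC_n` set: it is `n`-poised and each fundamental polynomial is a product of
`n` linear (degree-1) polynomials. -/
def GCSet (n : ℕ) (X : Set (ℝ × ℝ)) : Prop :=
  Poised n X ∧ ∀ A ∈ X, ∃ p : MvPolynomial (Fin 2) ℝ, IsFund n X A p ∧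
    ∃ f : Fin n → MvPolynomial (Fin 2) ℝ, (∀ i, IsLinePoly (f i)) ∧ p = ∏ i, f i

/-- The node `A` uses the line `l`: the linear polynomial `l` divides a fundamental
polynomial of `A`. -/
def Uses (n : ℕ) (X : Set (ℝ × ℝ)) (A : ℝ × ℝ) (l : MvPolynomial (Fin 2) ℝ) : Prop :=
  ∃ p, IsFund n X A p ∧ l ∣ p

/-- `X` has no maximal line, i.e. no line passes through `n+1` nodes of `X`. -/
def NoMaximalLine (n : ℕ) (X : Set (ℝ × ℝ)) : Prop :=
  ∀ l : MvPolynomial (Fin 2) ℝ, IsLinePoly l → nodesOn X l ≠ n + 1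

theorem IsLinePoly.exists_coeffs {l : MvPolynomial (Fin 2) ℝ} (hl : IsLinePoly l) :
    ∃ a b c : ℝ, (a ≠ 0 ∨ b ≠ 0) ∧ ∀ P : ℝ × ℝ, ev l P = a * P.1 + b * P.2 + c := by
  classical
  have hdeg : l.totalDegree = 1 := hl
  have hform : l = C (coeff 0 l) + C (coeff (Finsupp.single 0 1) l) * X 0
      + C (coeff (Finsupp.single 1 1) l) * X 1 := by
    have hne : (Finsupp.single (0 : Fin 2) 1 : Fin 2 →₀ ℕ) ≠ Finsupp.single 1 1 := by
      intro h
      simpa using DFunLike.congr_fun h 0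
    have hC : ∀ (r : ℝ) (i : Fin 2), C r * X i = monomial (Finsupp.single i 1) r := by
      intro r i
      rw [C_mul_X_eq_monomial]
    rw [hC, hC]
    ext m
    simp only [coeff_add, coeff_C, coeff_monomial]
    by_cases hm : m.degree ≤ 1
    · have hsum : m 0 + m 1 ≤ 1 := by
        simpa [Finsupp.degree_eq_sum, Fin.sum_univ_two] using hm
      have hcases : m = 0 ∨ m = Finsupp.single 0 1 ∨ m = Finsupp.single 1 1 := by
        have h3 : (m 0 = 0 ∧ m 1 = 0) ∨ (m 0 = 1 ∧ m 1 = 0) ∨ (m 0 = 0 ∧ m 1 = 1) := by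
          omega
        rcases h3 with h | h | h
        · left
          ext i
          fin_cases i <;> simp [h]
        · right; left
          ext i
          fin_cases i <;> simp [h]
        · right; right
          ext i
          fin_cases i <;> simp [h]
      rcases hcases with rfl | rfl | rfl
      · simp
      · simp [hne.symm, eq_comm]
      · simp [hne, eq_comm]
    · have h0 : coeff m l = 0 := by
        apply coeff_eq_zero_of_totalDegree_lt
        rw [hdeg]
        simpa [Finsupp.degree_apply] using hm
      have hm0 : (0 : Fin 2 →₀ ℕ) ≠ m := by
        rintro rfl
        simp at hm
      have hmi : ∀ i : Fin 2, (Finsupp.single i 1 : Fin 2 →₀ ℕ) ≠ m := by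
        rintro i rfl
        simp at hm
      simp [h0, hm0, hmi]
  generalize coeff 0 l = c, coeff (Finsupp.single 0 1) l = a,
    coeff (Finsupp.single 1 1) l = b at hform
  refine ⟨a, b, c, ?_, fun P => ?_⟩
  · by_contra! h
    simp [hform, h.1, h.2] at hdeg
  · rw [ev, hform]
    simp only [map_add, map_mul, eval_C, eval_X, Matrix.cons_val_zero, Matrix.cons_val_one]
    rw [add_assoc, add_comm]

theorem lineSet_eq_of_mem {l m : MvPolynomial (Fin 2) ℝ} (hl : IsLinePoly l) (hm : IsLinePoly m)
    {P Q : ℝ × ℝ} (hPQ : P ≠ Q) (hPl : P ∈ lineSet l) (hQl : Q ∈ lineSet l)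
    (hPm : P ∈ lineSet m) (hQm : Q ∈ lineSet m) : lineSet l = lineSet m := by
  suffices key : ∀ {l m : MvPolynomial (Fin 2) ℝ}, IsLinePoly l → IsLinePoly m →
      P ∈ lineSet l → Q ∈ lineSet l → P ∈ lineSet m → Q ∈ lineSet m →
      lineSet l ⊆ lineSet m from
    (key hl hm hPl hQl hPm hQm).antisymm (key hm hl hPm hQm hPl hQl)
  intro l m hl hm hPl hQl hPm hQm R hRl
  obtain ⟨a, b, c, hab, hev⟩ := hl.exists_coeffs
  obtain ⟨a', b', c', -, hev'⟩ := hm.exists_coeffs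
  simp only [lineSet, Set.mem_ofPred_eq, hev, hev'] at *
  have hsq : (P.1 - Q.1) ^ 2 + (P.2 - Q.2) ^ 2 ≠ 0 := by
    intro h
    apply hPQ
    ext <;> nlinarith [sq_nonneg (P.1 - Q.1), sq_nonneg (P.2 - Q.2)]
  have hcross : (R.1 - P.1) * (Q.2 - P.2) = (R.2 - P.2) * (Q.1 - P.1) := by
    rcases hab with h | h <;> apply mul_left_cancel₀ h <;> grind
  apply (mul_eq_zero.1 (?_ : ((P.1 - Q.1) ^ 2 + (P.2 - Q.2) ^ 2) *
    (a' * R.1 + b' * R.2 + c') = 0)).resolve_left hsq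
  grind

theorem IsLinePoly.infinite_lineSet {l : MvPolynomial (Fin 2) ℝ} (hl : IsLinePoly l) :
    (lineSet l).Infinite := by
  obtain ⟨a, b, c, hab, hev⟩ := hl.exists_coeffs
  by_cases hb : b = 0
  · have ha : a ≠ 0 := hab.resolve_right (not_not.2 hb)
    refine Set.infinite_of_injective_forall_mem (f := fun t : ℝ => (-c / a, t)) ?_ ?_
    · intro s t h
      simpa using h
    · intro t
      simp only [lineSet, Set.mem_ofPred_eq, hev, hb]
      field_simp
      ring
  · refine Set.infinite_of_injective_forall_mem (f := fun t : ℝ => (t, (-c - a * t) / b)) ?_ ?_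
    · intro s t h
      exact (Prod.ext_iff.1 h).1
    · intro t
      simp only [lineSet, Set.mem_ofPred_eq, hev]
      field_simp
      ring

theorem ev_prod_eq_zero_iff {n : ℕ} (f : Fin n → MvPolynomial (Fin 2) ℝ) (P : ℝ × ℝ) :
    ev (∏ i, f i) P = 0 ↔ ∃ i, P ∈ lineSet (f i) := by
  simp [ev, lineSet, map_prod, Finset.prod_eq_zero_iff]

/-- A line with more than `n` points covered by `n` lines is one of these lines. -/
theorem exists_lineSet_eq_of_card_lt {n : ℕ} {f : Fin n → MvPolynomial (Fin 2) ℝ}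
    (hf : ∀ i, IsLinePoly (f i)) {l : MvPolynomial (Fin 2) ℝ} (hl : IsLinePoly l)
    {T : Finset (ℝ × ℝ)} (hT : n < T.card)
    (hmem : ∀ P ∈ T, P ∈ lineSet l ∧ ev (∏ i, f i) P = 0) :
    ∃ i, lineSet (f i) = lineSet l := by
  have hcover : ∀ P ∈ T, ∃ i, P ∈ lineSet (f i) := fun P hP =>
    (ev_prod_eq_zero_iff f P).1 (hmem P hP).2
  have hne : Nonempty (Fin n) := by
    obtain ⟨P, hP⟩ := Finset.card_pos.1 (Nat.zero_lt_of_lt hT)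
    exact (hcover P hP).nonempty
  choose! g hg using hcover
  obtain ⟨P, hP, Q, hQ, hPQ, h⟩ := Finset.exists_ne_map_eq_of_card_lt_of_maps_to
    (t := Finset.univ) (f := g) (by simpa using hT) (fun _ _ => Finset.mem_univ _)
  exact ⟨g P, lineSet_eq_of_mem (hf _) hl hPQ (hg P hP) (h ▸ hg Q hQ)
    (hmem P hP).1 (hmem Q hQ).1⟩

theorem IsFund.eq {n : ℕ} {X : Set (ℝ × ℝ)} (hX : Poised n X) {A : ℝ × ℝ}
    {p q : MvPolynomial (Fin 2) ℝ} (hp : IsFund n X A p) (hq : IsFund n X A q) : p = q := by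
  refine sub_eq_zero.1 (hX.2.2 _ ((totalDegree_sub _ _).trans (max_le hp.1 hq.1)) fun B hB => ?_)
  have hsub : ev (p - q) B = ev p B - ev q B := by simp [ev]
  by_cases hBA : B = A
  · rw [hsub, hBA, hp.2.1, hq.2.1, sub_self]
  · rw [hsub, hp.2.2 B hB hBA, hq.2.2 B hB hBA, sub_self]

theorem GCSet.nodesOn_le {n : ℕ} {X : Set (ℝ × ℝ)} (hX : GCSet n X)
    {l : MvPolynomial (Fin 2) ℝ} (hl : IsLinePoly l) : nodesOn X l ≤ n + 1 := by
  classical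
  by_contra! hlt
  have hfin : (X ∩ lineSet l).Finite := hX.1.1.inter_of_left _
  rw [nodesOn, Set.ncard_eq_toFinset_card _ hfin] at hlt
  obtain ⟨A, hA⟩ := Finset.card_pos.1 (by omega : 0 < hfin.toFinset.card)
  have hA' := hfin.mem_toFinset.1 hA
  obtain ⟨_, hp, f, hf, rfl⟩ := hX.2 A hA'.1
  obtain ⟨i, hi⟩ := exists_lineSet_eq_of_card_lt hf hl (T := hfin.toFinset.erase A)
    (by rw [Finset.card_erase_of_mem hA]; omega) (fun P hP => by
      have hP' := hfin.mem_toFinset.1 (Finset.mem_of_mem_erase hP)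
      exact ⟨hP'.2, hp.2.2 P hP'.1 (Finset.ne_of_mem_erase hP)⟩)
  have h0 := (ev_prod_eq_zero_iff f A).2 ⟨i, hi ▸ hA'.2⟩
  exact one_ne_zero (hp.2.1.symm.trans h0)

/-- If a node `A` uses `l`, the nodes other than `A` off the line `l` are covered by the `n`
remaining lines of the fundamental polynomial of `A`. -/
theorem GCSet.exists_residual_lines {n : ℕ} {X : Set (ℝ × ℝ)} (hX : GCSet (n + 1) X)
    {l : MvPolynomial (Fin 2) ℝ} (hl : IsLinePoly l) {A : ℝ × ℝ} (hA : A ∈ X)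
    (hu : Uses (n + 1) X A l) :
    A ∉ lineSet l ∧ ∃ L : Finset (Set (ℝ × ℝ)), L.card ≤ n ∧
      (∀ s ∈ L, ∃ m, IsLinePoly m ∧ lineSet m = s) ∧ (∀ s ∈ L, A ∉ s) ∧
      ∀ P ∈ X, P ≠ A → P ∉ lineSet l → ∃ s ∈ L, P ∈ s := by
  classical
  obtain ⟨q, hq, hlq⟩ := hu
  obtain ⟨_, hp, f, hf, rfl⟩ := hX.2 A hA
  obtain rfl := hq.eq hX.1 hp
  have hvanish : ∀ P ∈ lineSet l, ev (∏ i, f i) P = 0 := by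
    intro P hP
    obtain ⟨r, hr⟩ := hlq
    rw [hr]
    have hP' : eval ![P.1, P.2] l = 0 := hP
    simp [ev, hP']
  have hAf : ∀ i, A ∉ lineSet (f i) := fun i hi =>
    one_ne_zero (hp.2.1.symm.trans ((ev_prod_eq_zero_iff f A).2 ⟨i, hi⟩))
  obtain ⟨T, hTl, hT⟩ := hl.infinite_lineSet.exists_subset_card_eq (n + 2)
  obtain ⟨i, hi⟩ := exists_lineSet_eq_of_card_lt hf hl (T := T) (by omega)
    (fun P hP => ⟨hTl hP, hvanish P (hTl hP)⟩)
  refine ⟨hi ▸ hAf i, (Finset.univ.erase i).image fun j => lineSet (f j), ?_, ?_, ?_, ?_⟩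
  · exact Finset.card_image_le.trans (by simp)
  · intro s hs
    obtain ⟨j, -, rfl⟩ := Finset.mem_image.1 hs
    exact ⟨f j, hf j, rfl⟩
  · intro s hs
    obtain ⟨j, -, rfl⟩ := Finset.mem_image.1 hs
    exact hAf j
  · intro P hP hPA hPl
    obtain ⟨j, hj⟩ := (ev_prod_eq_zero_iff f P).1 (hp.2.2 P hP hPA)
    refine ⟨lineSet (f j), Finset.mem_image_of_mem _ (Finset.mem_erase.2 ⟨?_, Finset.mem_univ _⟩),
      hj⟩
    rintro rfl
    exact hPl (hi ▸ hj)

/-- Points lying both on a line of `L` and on a line of `M` are on a common line or are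
intersection points of the other lines. -/
theorem card_le_of_covered_twice [DecidableEq (Set (ℝ × ℝ))] {Y : Finset (ℝ × ℝ)} {L M : Finset (Set (ℝ × ℝ))} {d k : ℕ}
    (hL : ∀ s ∈ L, ∃ m, IsLinePoly m ∧ lineSet m = s)
    (hM : ∀ s ∈ M, ∃ m, IsLinePoly m ∧ lineSet m = s)
    (hd : ∀ s ∈ L, ∀ Z ⊆ Y, (∀ P ∈ Z, P ∈ s) → Z.card ≤ d)
    (hYL : ∀ P ∈ Y, ∃ s ∈ L, P ∈ s) (hYM : ∀ P ∈ Y, ∃ s ∈ M, P ∈ s)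
    (hk : (L ∩ M).card = k) :
    Y.card ≤ k * d + (L.card - k) * (M.card - k) := by
  classical
  have hsub : Y ⊆ (L ∩ M).biUnion (fun s => Y.filter (· ∈ s)) ∪
      ((L \ M) ×ˢ (M \ L)).biUnion (fun st => Y.filter fun P => P ∈ st.1 ∧ P ∈ st.2) := by
    intro P hP
    obtain ⟨s, hs, hPs⟩ := hYL P hP
    obtain ⟨t, ht, hPt⟩ := hYM P hP
    simp only [Finset.mem_union, Finset.mem_biUnion, Finset.mem_filter, Finset.mem_inter,
      Finset.mem_product, Finset.mem_sdiff, Prod.exists]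
    by_cases hsM : s ∈ M
    · exact Or.inl ⟨s, ⟨hs, hsM⟩, hP, hPs⟩
    by_cases htL : t ∈ L
    · exact Or.inl ⟨t, ⟨htL, ht⟩, hP, hPt⟩
    · exact Or.inr ⟨s, t, ⟨⟨hs, hsM⟩, ht, htL⟩, hP, hPs, hPt⟩
  refine (Finset.card_le_card hsub).trans ((Finset.card_union_le _ _).trans (add_le_add ?_ ?_))
  · rw [← hk]
    refine Finset.card_biUnion_le_card_mul _ _ _ fun s hs => ?_
    exact hd s (Finset.mem_inter.1 hs).1 _ (Finset.filter_subset _ _)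
      fun P hP => (Finset.mem_filter.1 hP).2
  · have hcard : ((L \ M) ×ˢ (M \ L)).card = (L.card - k) * (M.card - k) := by
      rw [Finset.card_product, Finset.card_sdiff, Finset.card_sdiff, Finset.inter_comm M L, hk]
    rw [← hcard, ← mul_one ((L \ M) ×ˢ (M \ L)).card]
    refine Finset.card_biUnion_le_card_mul _ _ _ fun st hst => Finset.card_le_one.2 ?_
    intro P hP Q hQ
    simp only [Finset.mem_product, Finset.mem_sdiff, Finset.mem_filter] at hst hP hQ
    obtain ⟨m, hm, hms⟩ := hL _ hst.1.1
    obtain ⟨m', hm', hms'⟩ := hM _ hst.2.1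
    by_contra hPQ
    have heq := lineSet_eq_of_mem hm hm' hPQ (hms ▸ hP.2.1) (hms ▸ hQ.2.1)
      (hms' ▸ hP.2.2) (hms' ▸ hQ.2.2)
    rw [hms, hms'] at heq
    exact hst.1.2 (heq ▸ hst.2.1)

/-- in a `GC_5` set with no maximal line, a 2-node line is used by at most
one node of `X`. -/
theorem two_node_line_used_at_most_once (X : Set (ℝ × ℝ)) (hX : GCSet 5 X)
    (hnm : NoMaximalLine 5 X) (l : MvPolynomial (Fin 2) ℝ) (hl : IsLinePoly l)
    (h2 : nodesOn X l = 2) :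
    ∀ A ∈ X, ∀ B ∈ X, Uses 5 X A l → Uses 5 X B l → A = B := by
  classical
  intro A hA B hB huA huB
  by_contra hAB
  obtain ⟨hAl, L, hLcard, hL, hAL, hLcov⟩ := hX.exists_residual_lines hl hA huA
  obtain ⟨-, M, hMcard, hM, -, hMcov⟩ := hX.exists_residual_lines hl hB huB
  have hfin : X.Finite := hX.1.1
  let Y : Finset (ℝ × ℝ) := ((hfin.toFinset.filter (· ∉ lineSet l)).erase A).erase B
  have hY : ∀ P ∈ Y, P ∈ X ∧ P ∉ lineSet l ∧ P ≠ A ∧ P ≠ B := by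
    intro P hP
    simp only [Y, Finset.mem_erase, Finset.mem_filter, Set.Finite.mem_toFinset] at hP
    tauto
  have hYcard : 17 ≤ Y.card := by
    have hX21 : hfin.toFinset.card = 21 := by
      rw [← Set.ncard_eq_toFinset_card X hfin, hX.1.2.1]
    have hon : (hfin.toFinset.filter (· ∈ lineSet l)).card = 2 := by
      rw [← h2, nodesOn, ← Set.ncard_coe_finset]
      congr 1
      ext P
      simp
    have hsplit := Finset.card_filter_add_card_filter_not (s := hfin.toFinset) (· ∈ lineSet l)
    have h1 := Finset.pred_card_le_card_erase (s := hfin.toFinset.filter (· ∉ lineSet l)) (a := A)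
    have h3 := Finset.pred_card_le_card_erase
      (s := (hfin.toFinset.filter (· ∉ lineSet l)).erase A) (a := B)
    simp only [Y]
    omega
  have hcount := card_le_of_covered_twice (Y := Y) (d := 5) hL hM
    (fun s hs Z hZ hZs => by
      obtain ⟨m, hm, rfl⟩ := hL s hs
      have h6 : nodesOn X m ≤ 5 :=
        Nat.lt_succ_iff.1 (lt_of_le_of_ne (hX.nodesOn_le hm) (hnm m hm))
      refine le_trans ?_ h6
      rw [← Set.ncard_coe_finset]
      exact Set.ncard_le_ncard (fun P hP => ⟨(hY P (hZ hP)).1, hZs P hP⟩)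
        (hfin.inter_of_left _))
    (fun P hP => hLcov P (hY P hP).1 (hY P hP).2.2.1 (hY P hP).2.1)
    (fun P hP => hMcov P (hY P hP).1 (hY P hP).2.2.2 (hY P hP).2.1) rfl
  have hk : (L ∩ M).card < 4 := by
    by_contra! hk4
    have hML : M ⊆ L := by
      rw [← Finset.inter_eq_right]
      exact Finset.eq_of_subset_of_card_le Finset.inter_subset_right (hMcard.trans hk4)
    obtain ⟨s, hs, hAs⟩ := hMcov A hA hAB hAl
    exact hAL s (hML hs) hAs
  have hmul : (L.card - (L ∩ M).card) * (M.card - (L ∩ M).card) ≤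
      (4 - (L ∩ M).card) * (4 - (L ∩ M).card) := by
    gcongr
  have hle := hYcard.trans (hcount.trans (Nat.add_le_add_left hmul _))
  generalize (L ∩ M).card = k at hk hle
  interval_cases k <;> omega
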